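/- Let δ₀ > 0 and let φ : ℝ² → ℝ be smooth on a neighborhood of [−δ₀,δ₀]×[0,δ₀] with φ(0,y) = 0 for all y ∈ [0,δ₀]. Define u : (−δ₀,δ₀)×[0,δ₀) → ℂ by u(x,y) = 0 for x ≤ 0 and u(x,y) = exp(−1/(x + iφ(x,y))) for x > 0. Then there exists δ ∈ (0,δ₀] such that: (i) u is C^∞ on (−δ,δ)×[0,δ) and bounded; (ii) (1+iφ_x(x,y))·∂_y u(x,y) − iφ_y(x,y)·∂_x u(x,y) = 0 for all (x,y) ∈ (−δ,δ)×(0,δ), i.e., Lu = 0 for L = ∂/∂y − (iφ_y/(1+iφ_x))∂/∂x; (iii) ∫_{−ε}^{ε} ln|u(x,0)| dx = −∞ for every ε ∈ (0,δ); (iv) u(x,y) ≠ 0 whenever x > 0. -/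

import Mathlib

open MeasureTheory Set Filter Topology Complex

/-- Partial derivative in the `x` direction (complex-valued functions). -/
noncomputable def pdx (f : ℝ × ℝ → ℂ) (p : ℝ × ℝ) : ℂ := fderiv ℝ f p (1, 0)

/-- Partial derivative in the `y` direction (complex-valued functions). -/
noncomputable def pdy (f : ℝ × ℝ → ℂ) (p : ℝ × ℝ) : ℂ := fderiv ℝ f p (0, 1)

/-- Partial derivative in the `x` direction (real-valued functions). -/
noncomputable def pdxR (f : ℝ × ℝ → ℝ) (p : ℝ × ℝ) : ℝ := fderiv ℝ f p (1, 0)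

/-- Partial derivative in the `y` direction (real-valued functions). -/
noncomputable def pdyR (f : ℝ × ℝ → ℝ) (p : ℝ × ℝ) : ℝ := fderiv ℝ f p (0, 1)

/-- `∫_s ln|f| dx = -∞`, with the convention `ln 0 = -∞`: either `f` vanishes on a
set of positive measure, or `max(-ln|f|, 0)` has infinite integral over `s`. -/
def LogIntegralNegInf (f : ℝ → ℂ) (s : Set ℝ) : Prop :=
  0 < volume {x ∈ s | f x = 0} ∨
    ∫⁻ x in s, ENNReal.ofReal (max (-Real.log ‖f x‖) 0) = ⊤

/-- The function `z ↦ z⁻ᵏ exp (-1/z)` on the right half plane, extended by `0`. -/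
noncomputable def expNegInvDivPow (k : ℕ) (z : ℂ) : ℂ :=
  if z.re ≤ 0 then 0 else (z⁻¹) ^ k * Complex.exp (-z⁻¹)

/-- The closed double sector `‖z‖ ≤ C |re z|` around the real axis. -/
def doubleSector (C : ℝ) : Set ℂ := {z | ‖z‖ ≤ C * |z.re|}

lemma norm_expNegInvDivPow_le {C : ℝ} (hC : 0 < C) (k : ℕ) {z : ℂ} (hz : z ∈ doubleSector C) :
    ‖expNegInvDivPow k z‖ ≤ ‖z‖⁻¹ ^ k * Real.exp (-C⁻¹ * ‖z‖⁻¹) := by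
  unfold expNegInvDivPow
  split_ifs with h
  · rw [norm_zero]; positivity
  · push Not at h
    have hz0 : 0 < ‖z‖ := norm_pos_iff.2 fun h0 => by simp [h0] at h
    have hz' : ‖z‖ ≤ C * z.re := by simpa [doubleSector, abs_of_pos h] using hz
    rw [norm_mul, norm_pow, norm_inv, Complex.norm_exp, Complex.neg_re, Complex.inv_re,
      Complex.normSq_eq_norm_sq]
    gcongr
    rw [neg_mul, neg_le_neg_iff, ← mul_inv, inv_eq_one_div, div_le_div_iff₀ (by positivity)
      (by positivity)]
    nlinarith

lemma tendsto_expNegInvDivPow_zero {C : ℝ} (hC : 0 < C) (k : ℕ) :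
    Tendsto (expNegInvDivPow k) (𝓝[doubleSector C \ {0}] 0) (𝓝 0) := by
  have hinv : Tendsto (fun z : ℂ => ‖z‖⁻¹) (𝓝[doubleSector C \ {0}] 0) atTop := by
    refine tendsto_inv_nhdsGT_zero.comp ((tendsto_norm_nhdsNE_zero (E := ℂ)).mono_left ?_)
    exact nhdsWithin_mono _ fun z hz => hz.2
  have hlim := (tendsto_rpow_mul_exp_neg_mul_atTop_nhds_zero k C⁻¹ (inv_pos.2 hC)).comp hinv
  refine squeeze_zero_norm' ?_ hlim
  filter_upwards [self_mem_nhdsWithin] with z hz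
  simpa using norm_expNegInvDivPow_le hC k hz.1

lemma hasDerivWithinAt_expNegInvDivPow {C : ℝ} (hC : 0 < C) (k : ℕ) {z : ℂ}
    (hz : z ∈ doubleSector C) :
    HasDerivWithinAt (expNegInvDivPow k)
      (expNegInvDivPow (k + 2) z - k * expNegInvDivPow (k + 1) z) (doubleSector C) z := by
  rcases lt_trichotomy z.re 0 with h | h | h
  · have hev : expNegInvDivPow k =ᶠ[𝓝 z] fun _ => 0 := by
      filter_upwards [(isOpen_Iio.preimage Complex.continuous_re).mem_nhds h] with w hw
      exact if_pos (le_of_lt hw)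
    have h0 : ∀ m, expNegInvDivPow m z = 0 := fun m => if_pos h.le
    simpa [h0] using ((hasDerivAt_const z (0 : ℂ)).congr_of_eventuallyEq hev).hasDerivWithinAt
  · obtain rfl : z = 0 := by simpa [doubleSector, h] using hz
    have h0 : ∀ m, expNegInvDivPow m 0 = 0 := fun m => if_pos (by simp)
    rw [hasDerivWithinAt_iff_tendsto_slope]
    simp only [h0, mul_zero, sub_zero]
    refine (tendsto_expNegInvDivPow_zero hC (k + 1)).congr fun w => ?_
    rw [slope_def_module, h0, sub_zero, sub_zero, smul_eq_mul]
    unfold expNegInvDivPow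
    split_ifs <;> ring
  · have hz0 : z ≠ 0 := fun h0 => by simp [h0] at h
    have hev : expNegInvDivPow k =ᶠ[𝓝 z] fun w => (w⁻¹) ^ k * Complex.exp (-w⁻¹) := by
      filter_upwards [(isOpen_Ioi.preimage Complex.continuous_re).mem_nhds h] with w hw
      exact if_neg (not_le.2 hw)
    have hd := (((hasDerivAt_inv hz0).pow k).mul (hasDerivAt_inv hz0).neg.cexp)
    refine ((hd.congr_of_eventuallyEq hev).congr_deriv ?_).hasDerivWithinAt
    simp only [expNegInvDivPow, if_neg (not_le.2 h)]
    rcases k with _ | k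
    · simp; ring
    · simp [pow_succ]; field_simp; ring

lemma contDiffOn_expNegInvDivPow {C : ℝ} (hC : 0 < C) (n k : ℕ) :
    ContDiffOn ℂ n (expNegInvDivPow k) (doubleSector C) := by
  induction n generalizing k with
  | zero =>
    exact contDiffOn_zero.2 fun z hz =>
      (hasDerivWithinAt_expNegInvDivPow hC k hz).continuousWithinAt
  | succ n ih =>
    intro z hz
    rw [Nat.cast_succ, contDiffWithinAt_succ_iff_hasFDerivWithinAt (by simp)]
    refine ⟨doubleSector C, by simpa [insert_eq_of_mem hz] using self_mem_nhdsWithin, by simp, _,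
      fun w hw => (hasDerivWithinAt_expNegInvDivPow hC k hw).hasFDerivWithinAt, ?_⟩
    have hd : ContDiffWithinAt ℂ n
        (fun w => expNegInvDivPow (k + 2) w - k * expNegInvDivPow (k + 1) w) (doubleSector C) z :=
      ((ih (k + 2)).sub (contDiffOn_const.mul (ih (k + 1)))) z hz
    exact (ContinuousLinearMap.toSpanSingletonCLE (𝕜 := ℂ) (E := ℂ)).contDiff.comp_contDiffWithinAt hd

/-- A `C¹` function vanishing on `{0} × [0, b]` is `O(|x|)` on `[-a, a] × [0, b]`. -/
lemma exists_abs_le_mul_abs_fst {a b : ℝ} (ha : 0 < a) {φ : ℝ × ℝ → ℝ} {V : Set (ℝ × ℝ)}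
    (hV : IsOpen V) (hK : Icc (-a) a ×ˢ Icc 0 b ⊆ V) (hφ : ContDiffOn ℝ 1 φ V)
    (hφ0 : ∀ y ∈ Icc (0 : ℝ) b, φ (0, y) = 0) :
    ∃ M : ℝ, 0 ≤ M ∧ ∀ p ∈ Icc (-a) a ×ˢ Icc 0 b, |φ p| ≤ M * |p.1| := by
  obtain ⟨M, hM⟩ := (isCompact_Icc.prod isCompact_Icc).exists_bound_of_continuousOn
    ((hφ.continuousOn_fderiv_of_isOpen hV le_rfl).mono hK)
  refine ⟨max M 0, le_max_right _ _, fun p hp => ?_⟩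
  have h0 : ((0, p.2) : ℝ × ℝ) ∈ Icc (-a) a ×ˢ Icc 0 b := ⟨⟨by simp [ha.le], ha.le⟩, hp.2⟩
  have hmv := ((convex_Icc (-a) a).prod (convex_Icc 0 b)).norm_image_sub_le_of_norm_fderiv_le
    (f := φ) (𝕜 := ℝ) (fun q hq => (hφ.contDiffAt (hV.mem_nhds (hK hq))).differentiableAt one_ne_zero)
    (fun q hq => (hM q hq).trans (le_max_left M 0)) h0 hp
  rw [hφ0 _ hp.2, sub_zero] at hmv
  simpa [Prod.norm_def] using hmv

/-- The explicit counterexample of Section 2: when `φ(0,·) ≡ 0` on `[0,δ₀]` the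
function `u = 0` for `x ≤ 0`, `u = exp(-1/(x+iφ(x,y)))` for `x > 0` is a bounded
smooth one-sided solution of `Lu = 0` with `∫ ln|u(x,0)| dx = -∞` that does not
vanish for `x > 0`. -/
theorem explicit_counterexample
    (δ₀ : ℝ) (hδ₀ : 0 < δ₀)
    (φ : ℝ × ℝ → ℝ)
    (hφ : ∃ V : Set (ℝ × ℝ), IsOpen V ∧ Icc (-δ₀) δ₀ ×ˢ Icc 0 δ₀ ⊆ V ∧
      ContDiffOn ℝ (⊤ : ℕ∞) φ V)
    (hφ0 : ∀ y ∈ Icc (0 : ℝ) δ₀, φ (0, y) = 0)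
    (u : ℝ × ℝ → ℂ)
    (hu_def : ∀ p ∈ Ioo (-δ₀) δ₀ ×ˢ Ico 0 δ₀,
      u p = if p.1 ≤ 0 then 0 else Complex.exp (-(1 / (p.1 + φ p * Complex.I)))) :
    ∃ δ : ℝ, 0 < δ ∧ δ ≤ δ₀ ∧
      -- (i) `u` is smooth up to the boundary and bounded
      ContDiffOn ℝ (⊤ : ℕ∞) u (Ioo (-δ) δ ×ˢ Ico 0 δ) ∧
      (∃ C : ℝ, ∀ p ∈ Ioo (-δ) δ ×ˢ Ico 0 δ, ‖u p‖ ≤ C) ∧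
      -- (ii) `Lu = 0` on `(-δ,δ) × (0,δ)`
      (∀ p ∈ Ioo (-δ) δ ×ˢ Ioo 0 δ,
        (1 + Complex.I * (pdxR φ p)) * pdy u p - Complex.I * (pdyR φ p) * pdx u p = 0) ∧
      -- (iii) divergent logarithmic integral of the boundary value
      (∀ ε : ℝ, 0 < ε → ε < δ → LogIntegralNegInf (fun x => u (x, 0)) (Ioo (-ε) ε)) ∧
      -- (iv) `u` does not vanish for `x > 0`
      (∀ p ∈ Ioo (-δ) δ ×ˢ Ico 0 δ, 0 < p.1 → u p ≠ 0) := by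
  obtain ⟨V, hV, hK, hφV⟩ := hφ
  obtain ⟨M, hM0, hM⟩ := exists_abs_le_mul_abs_fst hδ₀ hV hK (hφV.of_le (by simp)) hφ0
  have hC : 0 < 1 + M := by positivity
  have hsub : Ioo (-δ₀) δ₀ ×ˢ Ico 0 δ₀ ⊆ Icc (-δ₀) δ₀ ×ˢ Icc 0 δ₀ :=
    prod_mono Ioo_subset_Icc_self Ico_subset_Icc_self
  set Z : ℝ × ℝ → ℂ := fun p => p.1 + φ p * Complex.I with hZ
  have hZre : ∀ p, (Z p).re = p.1 := fun p => by simp [hZ]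
  have hmaps : MapsTo Z (Ioo (-δ₀) δ₀ ×ˢ Ico 0 δ₀) (doubleSector (1 + M)) := fun p hp => by
    have h1 : ‖Z p‖ ≤ |p.1| + |φ p| := (norm_add_le _ _).trans (by simp)
    have h2 := hM p (hsub hp)
    simp only [doubleSector, mem_ofPred_eq, hZre]
    linarith
  have hu : EqOn u (expNegInvDivPow 0 ∘ Z) (Ioo (-δ₀) δ₀ ×ˢ Ico 0 δ₀) := fun p hp => by
    simp [hu_def p hp, expNegInvDivPow, hZ]
  refine ⟨δ₀, hδ₀, le_rfl, ?_, ⟨1, fun p hp => ?_⟩, fun p hp => ?_, fun ε hε hεδ => Or.inl ?_,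
    fun p hp h => ?_⟩
  · have hZs : ContDiffOn ℝ (⊤ : ℕ∞) Z (Ioo (-δ₀) δ₀ ×ˢ Ico 0 δ₀) :=
      (Complex.ofRealCLM.contDiff.comp contDiff_fst).contDiffOn.add
        ((Complex.ofRealCLM.contDiff.comp_contDiffOn (hφV.mono (hsub.trans hK))).mul
          contDiffOn_const)
    refine ContDiffOn.congr ?_ hu
    refine ContDiffOn.comp (contDiffOn_infty.2 fun n => ?_) hZs hmaps
    exact (contDiffOn_expNegInvDivPow hC n 0).restrict_scalars ℝ
  · rw [hu hp, Function.comp_apply]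
    refine (norm_expNegInvDivPow_le hC 0 (hmaps hp)).trans ?_
    rw [pow_zero, one_mul, Real.exp_le_one_iff, neg_mul, neg_nonpos]
    positivity
  · have hsub' : Ioo (-δ₀) δ₀ ×ˢ Ioo 0 δ₀ ⊆ Ioo (-δ₀) δ₀ ×ˢ Ico 0 δ₀ :=
      prod_mono_right Ioo_subset_Ico_self
    have hnhds : Ioo (-δ₀) δ₀ ×ˢ Ico 0 δ₀ ∈ 𝓝 p :=
      mem_of_superset ((isOpen_Ioo.prod isOpen_Ioo).mem_nhds hp) hsub'
    have hφp : HasFDerivAt φ (fderiv ℝ φ p) p :=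
      ((hφV.contDiffAt (hV.mem_nhds (hK (hsub (hsub' hp))))).differentiableAt
        (by simp)).hasFDerivAt
    have hZp : HasFDerivAt Z _ p :=
      (Complex.ofRealCLM.hasFDerivAt.comp p hasFDerivAt_fst).add
        ((Complex.ofRealCLM.hasFDerivAt.comp p hφp).mul_const Complex.I)
    have hg := (hasDerivWithinAt_expNegInvDivPow hC 0 (hmaps (hsub' hp))).hasFDerivWithinAt
      |>.restrictScalars ℝ
    have hup := ((hg.comp p hZp.hasFDerivWithinAt hmaps).hasFDerivAt hnhds).congr_of_eventuallyEq
      (hu.eventuallyEq_of_mem hnhds)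
    simp only [pdx, pdy, pdxR, pdyR, hup.fderiv]
    simp
    ring
  · have hss : Ioo (-ε) 0 ⊆ {x ∈ Ioo (-ε) ε | u (x, 0) = 0} := fun x hx => by
      refine ⟨⟨hx.1, hx.2.trans hε⟩, ?_⟩
      rw [hu_def _ ⟨⟨by linarith [hx.1], by linarith [hx.2]⟩, ⟨le_rfl, hδ₀⟩⟩]
      exact if_pos hx.2.le
    refine lt_of_lt_of_le ?_ (measure_mono hss)
    simp [hε]
  · rw [hu_def p hp, if_neg (not_le.2 h)]
    exact Complex.exp_ne_zero _
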